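/- arXiv:1805.12529 — 2 statements merged into one kernel-verified Lean document; each statement's English description precedes it below -/
import Mathlib

section
/- Let Z*, Δ ∈ ℝ^{n×N} be such that S(Δ_{(k,·)}) ⊆ S(Z*_{(k,·)}) for every k ∈ {1,…,n}. Then ½ ‖Δ (Z*)^T − Z* Δ^T‖_F ≤ (max_{1≤k≤n} ‖D_k Z* D̃_k‖_2) · ‖Δ‖_F. -/
open Matrix MeasureTheory ProbabilityTheory Filter
open scoped Kronecker

noncomputable section

/-- Frobenius norm of a real matrix. -/
def frobNorm {m n : Type*} [Fintype m] [Fintype n] (M : Matrix m n ℝ) : ℝ :=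
  Real.sqrt (∑ i, ∑ j, (M i j) ^ 2)

/-- Spectral norm (largest singular value) of a real matrix. -/
def specNorm {m n : Type*} [Fintype m] [Fintype n] [DecidableEq n] (M : Matrix m n ℝ) : ℝ :=
  ‖LinearMap.toContinuousLinearMap (Matrix.toEuclideanLin M)‖

/-- Smallest singular value of a real matrix (as the infimum of `‖Mᵀ x‖` over unit vectors). -/
def sigmaMin {m n : Type*} [Fintype m] [Fintype n] [DecidableEq m] (M : Matrix m n ℝ) : ℝ :=
  sInf {c : ℝ | ∃ x : EuclideanSpace ℝ m, ‖x‖ = 1 ∧ c = ‖Matrix.toEuclideanLin Mᵀ x‖}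

/-- Condition number: ratio of largest to smallest singular value. -/
def condNum {m n : Type*} [Fintype m] [Fintype n] [DecidableEq m] [DecidableEq n]
    (M : Matrix m n ℝ) : ℝ :=
  specNorm M / sigmaMin M

/-- `D_k`: diagonal matrix with ones on the diagonal except a zero at `(k,k)`. -/
def Dk {n : Type*} [Fintype n] [DecidableEq n] (k : n) : Matrix n n ℝ :=
  Matrix.diagonal (fun i => if i = k then 0 else 1)

/-- `D̃_k`: diagonal matrix with ones at columns in the support of the `k`-th row of `Z`. -/
def Dtil {n N : Type*} [Fintype n] [Fintype N] [DecidableEq N]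
    (Z : Matrix n N ℝ) (k : n) : Matrix N N ℝ :=
  Matrix.diagonal (fun j => if Z k j ≠ 0 then 1 else 0)

/-- `max_{1 ≤ k ≤ n} ‖D_k Z D̃_k‖₂`. -/
def qmax {n N : Type*} [Fintype n] [Fintype N] [DecidableEq n] [DecidableEq N]
    (Z : Matrix n N ℝ) : ℝ :=
  ⨆ k : n, specNorm (Dk k * Z * Dtil Z k)

/-- `z = H_s(v)`: hard thresholding of `v` to its `s` largest-magnitude entries. -/
def IsHardThresh {n : ℕ} (s : ℕ) (v z : Fin n → ℝ) : Prop :=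
  ∃ T : Finset (Fin n), T.card = s ∧ (∀ i ∈ T, ∀ j ∉ T, |v j| ≤ |v i|) ∧
    (∀ i ∈ T, z i = v i) ∧ (∀ i ∉ T, z i = 0)

/-- Euclidean norm of a vector. -/
def l2norm {n : ℕ} (v : Fin n → ℝ) : ℝ := Real.sqrt (∑ i, (v i) ^ 2)

/-- `β(v)`: smallest magnitude among the nonzero entries of `v`. -/
def betaMin {n : ℕ} (v : Fin n → ℝ) : ℝ :=
  sInf {c : ℝ | ∃ i, v i ≠ 0 ∧ c = |v i|}

/-- The constant `C(ε₀)` from the convergence-radius analysis. -/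
def Cconst (e : ℝ) : ℝ :=
  2 + 9 * Real.sqrt 2 / (8 * (1 - 2 * e - e ^ 2) ^ ((3 : ℝ) / 2)) + Real.sqrt 2 / (1 - e)

end
/-- A matrix contracts sums of squares up to its squared spectral norm. -/
theorem sum_sq_mulVec_le_specNorm {m n : Type*} [Fintype m] [Fintype n] [DecidableEq n]
    (M : Matrix m n ℝ) (v : n → ℝ) :
    ∑ i, (M *ᵥ v) i ^ 2 ≤ specNorm M ^ 2 * ∑ j, v j ^ 2 := by
  have h := (LinearMap.toContinuousLinearMap (Matrix.toEuclideanLin M)).le_opNorm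
    (WithLp.toLp 2 v)
  have h2 := pow_le_pow_left₀ (norm_nonneg _) h 2
  rw [mul_pow, EuclideanSpace.norm_sq_eq, EuclideanSpace.norm_sq_eq] at h2
  simpa [specNorm] using h2

/-- Each compressed matrix has spectral norm at most the maximum. -/
theorem specNorm_le_qmax {n N : Type*} [Fintype n] [Fintype N] [DecidableEq n] [DecidableEq N]
    (Z : Matrix n N ℝ) (k : n) : specNorm (Dk k * Z * Dtil Z k) ≤ qmax Z :=
  le_ciSup (f := fun k => specNorm (Dk k * Z * Dtil Z k)) (Set.finite_range _).bddAbove k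

theorem qmax_nonneg {n N : Type*} [Fintype n] [Fintype N] [DecidableEq n] [DecidableEq N]
    (Z : Matrix n N ℝ) : 0 ≤ qmax Z :=
  Real.iSup_nonneg fun _ => norm_nonneg _

/-- On vectors supported in the `k`-th row of `Z`, the compressed matrix acts as `Z` with its
`k`-th output coordinate deleted. -/
theorem compressed_mulVec {n N : Type*} [Fintype n] [Fintype N] [DecidableEq n] [DecidableEq N]
    (Z : Matrix n N ℝ) (k : n) (v : N → ℝ) (hv : ∀ j, v j ≠ 0 → Z k j ≠ 0) (i : n) :
    ((Dk k * Z * Dtil Z k) *ᵥ v) i = if i = k then 0 else (Z *ᵥ v) i := by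
  have hD : Dtil Z k *ᵥ v = v := by
    ext j
    rw [Dtil, Matrix.mulVec_diagonal]
    by_cases h : v j = 0
    · simp [h]
    · simp [hv j h]
  rw [← Matrix.mulVec_mulVec, hD, ← Matrix.mulVec_mulVec, Dk, Matrix.mulVec_diagonal]
  split_ifs <;> simp

/-- The skew part of a matrix is controlled by its off-diagonal entries. -/
theorem sum_sq_sub_transpose_le {n : Type*} [Fintype n] [DecidableEq n] (A : Matrix n n ℝ) :
    ∑ k, ∑ i, (A k i - A i k) ^ 2 ≤ 4 * ∑ k, ∑ i, (if i = k then 0 else A k i) ^ 2 := by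
  have hcomm : ∑ k, ∑ i, (if i = k then 0 else A i k) ^ 2 =
      ∑ k, ∑ i, (if i = k then 0 else A k i) ^ 2 := by
    rw [Finset.sum_comm]
    simp only [eq_comm]
  calc ∑ k, ∑ i, (A k i - A i k) ^ 2
      ≤ ∑ k, ∑ i, (2 * (if i = k then 0 else A k i) ^ 2 +
          2 * (if i = k then 0 else A i k) ^ 2) := by
        refine Finset.sum_le_sum fun k _ => Finset.sum_le_sum fun i _ => ?_
        split_ifs with h
        · simp [h]
        · nlinarith [sq_nonneg (A k i + A i k)]
    _ = 4 * ∑ k, ∑ i, (if i = k then 0 else A k i) ^ 2 := by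
        simp only [Finset.sum_add_distrib, ← Finset.mul_sum]
        rw [hcomm]
        ring

/-- the skew-symmetric term bound. -/
theorem stmt10 (n N : ℕ) (Zstar Δ : Matrix (Fin n) (Fin N) ℝ)
    (hsupp : ∀ k : Fin n, {j : Fin N | Δ k j ≠ 0} ⊆ {j : Fin N | Zstar k j ≠ 0}) :
    (1 / 2) * frobNorm (Δ * Zstarᵀ - Zstar * Δᵀ) ≤ qmax Zstar * frobNorm Δ := by
  have hrow : ∀ k i, (Δ * Zstarᵀ) k i = (Zstar *ᵥ Δ k) i := fun k i => by
    simp [Matrix.mul_apply, Matrix.mulVec, dotProduct, mul_comm]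
  have hentry : ∀ k i, (Δ * Zstarᵀ - Zstar * Δᵀ) k i =
      (Δ * Zstarᵀ) k i - (Δ * Zstarᵀ) i k := fun k i => by
    simp [Matrix.mul_apply, mul_comm]
  have hoff : ∑ k, ∑ i, (if i = k then 0 else (Δ * Zstarᵀ) k i) ^ 2 ≤
      qmax Zstar ^ 2 * ∑ k, ∑ j, Δ k j ^ 2 := by
    rw [Finset.mul_sum]
    refine Finset.sum_le_sum fun k _ => ?_
    calc ∑ i, (if i = k then 0 else (Δ * Zstarᵀ) k i) ^ 2
        = ∑ i, ((Dk k * Zstar * Dtil Zstar k) *ᵥ Δ k) i ^ 2 := by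
          refine Finset.sum_congr rfl fun i _ => ?_
          rw [compressed_mulVec Zstar k (Δ k) (fun j hj => hsupp k hj), hrow]
      _ ≤ specNorm (Dk k * Zstar * Dtil Zstar k) ^ 2 * ∑ j, Δ k j ^ 2 :=
          sum_sq_mulVec_le_specNorm _ _
      _ ≤ qmax Zstar ^ 2 * ∑ j, Δ k j ^ 2 := by
          gcongr
          · exact norm_nonneg _
          · exact specNorm_le_qmax Zstar k
  have hsq : ∑ k, ∑ i, (Δ * Zstarᵀ - Zstar * Δᵀ) k i ^ 2 ≤
      (2 * qmax Zstar) ^ 2 * ∑ k, ∑ j, Δ k j ^ 2 := by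
    simp only [hentry]
    linarith [sum_sq_sub_transpose_le (Δ * Zstarᵀ)]
  have hfrob : frobNorm (Δ * Zstarᵀ - Zstar * Δᵀ) ≤ 2 * qmax Zstar * frobNorm Δ := by
    have h := Real.sqrt_le_sqrt hsq
    rwa [Real.sqrt_mul (sq_nonneg _),
      Real.sqrt_sq (mul_nonneg zero_le_two (qmax_nonneg Zstar))] at h
  linarith
end

section
/- Let Z* ∈ ℝ^{n×N} have full row rank with ‖Z*‖_2 = 1, let G = Z*(Z*)^T, and let G = Q Λ Q^T with Q orthogonal and Λ diagonal with positive diagonal entries. Define H := (G^{−1} ⊗ Id)(Q ⊗ Q)(Id ⊗ Λ + Λ ⊗ Id)^{−1}(Λ ⊗ Id)(Q ⊗ Q)^T. Then ‖H‖_2 ≤ κ(Z*)^4 / 2. -/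
open Matrix MeasureTheory ProbabilityTheory Filter
open scoped Kronecker

section SpectralNorm

open scoped Matrix.Norms.L2Operator

variable {m n : Type*} [Fintype m] [Fintype n] [DecidableEq n]

lemma specNorm_eq_l2_opNorm (M : Matrix m n ℝ) : specNorm M = ‖M‖ := rfl

lemma specNorm_mul_le {l : Type*} [Fintype l] [DecidableEq m] (A : Matrix l m ℝ) (B : Matrix m n ℝ) :
    specNorm (A * B) ≤ specNorm A * specNorm B :=
  Matrix.l2_opNorm_mul A B

lemma specNorm_transpose [DecidableEq m] (M : Matrix m n ℝ) : specNorm Mᵀ = specNorm M := by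
  rw [specNorm_eq_l2_opNorm, specNorm_eq_l2_opNorm, ← Matrix.conjTranspose_eq_transpose_of_trivial,
    Matrix.l2_opNorm_conjTranspose]

lemma norm_toEuclideanLin_le (M : Matrix m n ℝ) (x : EuclideanSpace ℝ n) :
    ‖Matrix.toEuclideanLin M x‖ ≤ specNorm M * ‖x‖ :=
  (LinearMap.toContinuousLinearMap (Matrix.toEuclideanLin M)).le_opNorm x

lemma norm_toEuclideanLin_sq (M : Matrix m n ℝ) (x : EuclideanSpace ℝ n) :
    ‖Matrix.toEuclideanLin M x‖ ^ 2 = x.ofLp ⬝ᵥ ((Mᵀ * M) *ᵥ x.ofLp) := by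
  rw [EuclideanSpace.real_norm_sq_eq, ← Matrix.mulVec_mulVec, Matrix.dotProduct_mulVec,
    Matrix.vecMul_transpose]
  simp [Matrix.toLpLin_apply, dotProduct, sq]

lemma specNorm_nonneg (M : Matrix m n ℝ) : 0 ≤ specNorm M := norm_nonneg _

lemma specNorm_diagonal_le {v : n → ℝ} {c : ℝ} (hc : 0 ≤ c) (h : ∀ i, |v i| ≤ c) :
    specNorm (Matrix.diagonal v) ≤ c := by
  rw [specNorm_eq_l2_opNorm, Matrix.l2_opNorm_diagonal]
  exact (pi_norm_le_iff_of_nonneg hc).2 h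

lemma specNorm_le_one_of_transpose_mul_self {U : Matrix m n ℝ} (hU : Uᵀ * U = 1) :
    specNorm U ≤ 1 := by
  have h : ‖U‖ * ‖U‖ = ‖(1 : Matrix n n ℝ)‖ := by
    rw [← Matrix.l2_opNorm_conjTranspose_mul_self,
      Matrix.conjTranspose_eq_transpose_of_trivial, hU]
  have h_one : ‖(1 : Matrix n n ℝ)‖ ≤ 1 := by
    rw [← Matrix.diagonal_one]
    exact specNorm_diagonal_le zero_le_one (by simp)
  rw [specNorm_eq_l2_opNorm]
  nlinarith [norm_nonneg U]

end SpectralNorm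

section SmallestSingularValue

variable {m n : Type*} [Fintype m] [Fintype n] [DecidableEq m]

lemma sigmaMin_le (M : Matrix m n ℝ) {x : EuclideanSpace ℝ m} (hx : ‖x‖ = 1) :
    sigmaMin M ≤ ‖Matrix.toEuclideanLin Mᵀ x‖ :=
  csInf_le ⟨0, by rintro c ⟨y, -, rfl⟩; exact norm_nonneg _⟩ ⟨x, hx, rfl⟩

lemma sigmaMin_nonneg (M : Matrix m n ℝ) : 0 ≤ sigmaMin M :=
  Real.sInf_nonneg (by rintro c ⟨y, -, rfl⟩; exact norm_nonneg _)

lemma exists_norm_eq_one_euclideanSpace [Nonempty m] : ∃ x : EuclideanSpace ℝ m, ‖x‖ = 1 :=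
  ⟨EuclideanSpace.single (Classical.arbitrary m) 1, by simp⟩

lemma sigmaMin_le_specNorm [DecidableEq n] [Nonempty m] (M : Matrix m n ℝ) : sigmaMin M ≤ specNorm M := by
  obtain ⟨x, hx⟩ := exists_norm_eq_one_euclideanSpace (m := m)
  have h := norm_toEuclideanLin_le Mᵀ x
  rw [hx, mul_one, specNorm_transpose] at h
  exact (sigmaMin_le M hx).trans h

lemma sigmaMin_pos_of_mul_transpose_eq_one [DecidableEq n] [Nonempty m]
    {M W : Matrix m n ℝ} (h : W * Mᵀ = 1) : 0 < sigmaMin M := by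
  have key (x : EuclideanSpace ℝ m) (hx : ‖x‖ = 1) :
      1 ≤ specNorm W * ‖Matrix.toEuclideanLin Mᵀ x‖ := by
    have hWx : Matrix.toEuclideanLin W (Matrix.toEuclideanLin Mᵀ x) = x := by
      simp [Matrix.toLpLin_apply, Matrix.mulVec_mulVec, h]
    simpa [hWx, hx] using norm_toEuclideanLin_le W (Matrix.toEuclideanLin Mᵀ x)
  obtain ⟨x, hx⟩ := exists_norm_eq_one_euclideanSpace (m := m)
  have hW : 0 < specNorm W := by
    by_contra hW
    have := key x hx
    rw [le_antisymm (not_lt.1 hW) (specNorm_nonneg W)] at this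
    norm_num at this
  refine (inv_pos.2 hW).trans_le (le_csInf ⟨_, x, hx, rfl⟩ ?_)
  rintro c ⟨y, hy, rfl⟩
  rw [inv_eq_one_div, div_le_iff₀' hW]
  exact key y hy

lemma sigmaMin_sq_le_of_mul_transpose_eq {M : Matrix m n ℝ} {Q : Matrix m m ℝ} {d : m → ℝ}
    (hQ : Qᵀ * Q = 1) (hM : M * Mᵀ = Q * Matrix.diagonal d * Qᵀ) (i : m) :
    sigmaMin M ^ 2 ≤ d i := by
  let x := Matrix.toEuclideanLin Q (EuclideanSpace.single i 1)
  have hx : ‖x‖ = 1 := by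
    have h := norm_toEuclideanLin_sq Q (EuclideanSpace.single i 1)
    rw [hQ] at h
    have h' : ‖x‖ ^ 2 = 1 := by simpa using h
    nlinarith [norm_nonneg x]
  have hd : ‖Matrix.toEuclideanLin Mᵀ x‖ ^ 2 = d i := by
    have hcomp : Matrix.toEuclideanLin Mᵀ x
        = Matrix.toEuclideanLin (Mᵀ * Q) (EuclideanSpace.single i 1) := by
      simp [x, Matrix.toLpLin_apply]
    have hmul : (Mᵀ * Q)ᵀ * (Mᵀ * Q) = Matrix.diagonal d := by
      calc (Mᵀ * Q)ᵀ * (Mᵀ * Q) = Qᵀ * (M * Mᵀ) * Q := by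
            simp only [Matrix.transpose_mul, Matrix.transpose_transpose, Matrix.mul_assoc]
        _ = (Qᵀ * Q) * Matrix.diagonal d * (Qᵀ * Q) := by
            simp only [hM, Matrix.mul_assoc]
        _ = Matrix.diagonal d := by rw [hQ, Matrix.one_mul, Matrix.mul_one]
    rw [hcomp, norm_toEuclideanLin_sq, hmul]
    simp
  rw [← hd]
  exact pow_le_pow_left₀ (sigmaMin_nonneg M) (sigmaMin_le M hx) 2

end SmallestSingularValue

section Kronecker

variable {n : Type*} [Fintype n] [DecidableEq n]

lemma inv_mul_diagonal_mul_transpose {Q : Matrix n n ℝ} (hQ : Qᵀ * Q = 1) {d : n → ℝ}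
    (hd : ∀ i, 0 < d i) :
    (Q * Matrix.diagonal d * Qᵀ)⁻¹ = Q * Matrix.diagonal (fun i => (d i)⁻¹) * Qᵀ := by
  refine Matrix.inv_eq_right_inv ?_
  have hdd : Matrix.diagonal d * Matrix.diagonal (fun i => (d i)⁻¹) = 1 := by
    simp [Matrix.diagonal_mul_diagonal, (hd _).ne']
  calc Q * Matrix.diagonal d * Qᵀ * (Q * Matrix.diagonal (fun i => (d i)⁻¹) * Qᵀ)
      = Q * (Matrix.diagonal d * (Qᵀ * Q) * Matrix.diagonal (fun i => (d i)⁻¹)) * Qᵀ := by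
        simp only [Matrix.mul_assoc]
    _ = 1 := by rw [hQ, Matrix.mul_one, hdd, Matrix.mul_one, mul_eq_one_comm.1 hQ]

lemma kronecker_diagonal_conj_eq {Q : Matrix n n ℝ} (hQ : Qᵀ * Q = 1) {d : n → ℝ}
    (hd : ∀ i, 0 < d i) :
    ((Q * Matrix.diagonal d * Qᵀ)⁻¹ ⊗ₖ (1 : Matrix n n ℝ)) * (Q ⊗ₖ Q) *
      ((1 : Matrix n n ℝ) ⊗ₖ Matrix.diagonal d + Matrix.diagonal d ⊗ₖ (1 : Matrix n n ℝ))⁻¹ *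
      (Matrix.diagonal d ⊗ₖ (1 : Matrix n n ℝ)) * (Q ⊗ₖ Q)ᵀ =
    (Q ⊗ₖ Q) * Matrix.diagonal (fun p : n × n => (d p.1 + d p.2)⁻¹) * (Q ⊗ₖ Q)ᵀ := by
  have hpos (p : n × n) : 0 < d p.1 + d p.2 := add_pos (hd _) (hd _)
  have hL : Matrix.diagonal d ⊗ₖ (1 : Matrix n n ℝ)
      = Matrix.diagonal (fun p : n × n => d p.1) := by
    simp [← Matrix.diagonal_one, Matrix.diagonal_kronecker_diagonal]
  have hLinv : Matrix.diagonal (fun i => (d i)⁻¹) ⊗ₖ (1 : Matrix n n ℝ)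
      = Matrix.diagonal (fun p : n × n => (d p.1)⁻¹) := by
    simp [← Matrix.diagonal_one, Matrix.diagonal_kronecker_diagonal]
  have hR : (1 : Matrix n n ℝ) ⊗ₖ Matrix.diagonal d
      = Matrix.diagonal (fun p : n × n => d p.2) := by
    simp [← Matrix.diagonal_one, Matrix.diagonal_kronecker_diagonal]
  have hS : ((1 : Matrix n n ℝ) ⊗ₖ Matrix.diagonal d + Matrix.diagonal d ⊗ₖ 1)⁻¹
      = Matrix.diagonal (fun p : n × n => (d p.1 + d p.2)⁻¹) := by
    refine Matrix.inv_eq_right_inv ?_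
    rw [hL, hR, Matrix.diagonal_add, Matrix.diagonal_mul_diagonal, ← Matrix.diagonal_one]
    congr 1
    funext p
    rw [add_comm (d p.2), mul_inv_cancel₀ (hpos p).ne']
  have hcomm : ((Q * Matrix.diagonal d * Qᵀ)⁻¹ ⊗ₖ (1 : Matrix n n ℝ)) * (Q ⊗ₖ Q)
      = (Q ⊗ₖ Q) * Matrix.diagonal (fun p : n × n => (d p.1)⁻¹) := by
    rw [inv_mul_diagonal_mul_transpose hQ hd, ← hLinv, ← Matrix.mul_kronecker_mul,
      ← Matrix.mul_kronecker_mul, Matrix.one_mul, Matrix.mul_one, Matrix.mul_assoc, hQ,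
      Matrix.mul_one]
  rw [hcomm, hS, hL, Matrix.mul_assoc (Q ⊗ₖ Q), Matrix.diagonal_mul_diagonal,
    Matrix.mul_assoc (Q ⊗ₖ Q), Matrix.diagonal_mul_diagonal]
  congr 3
  funext p
  field_simp [(hd p.1).ne', (hpos p).ne']

lemma specNorm_conj_le {l : Type*} [Fintype l] [DecidableEq l] {U : Matrix l n ℝ}
    (hU : Uᵀ * U = 1) (A : Matrix n n ℝ) : specNorm (U * A * Uᵀ) ≤ specNorm A := by
  have h := specNorm_le_one_of_transpose_mul_self hU
  calc specNorm (U * A * Uᵀ) ≤ specNorm U * specNorm A * specNorm Uᵀ :=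
        (specNorm_mul_le _ _).trans
          (mul_le_mul_of_nonneg_right (specNorm_mul_le _ _) (specNorm_nonneg _))
    _ ≤ 1 * specNorm A * 1 := by
        rw [specNorm_transpose]
        have := specNorm_nonneg U
        have := specNorm_nonneg A
        gcongr
    _ = specNorm A := by ring

end Kronecker

/-- spectral-norm bound `‖H‖₂ ≤ κ(Z*)⁴ / 2` for the Kronecker-algebra
matrix appearing in the operator-update analysis. -/
theorem stmt14 (n N : ℕ) (Zstar : Matrix (Fin n) (Fin N) ℝ)
    (hrank : Zstar.rank = n) (hZnorm : specNorm Zstar = 1)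
    (G : Matrix (Fin n) (Fin n) ℝ) (hG : G = Zstar * Zstarᵀ)
    (Q : Matrix (Fin n) (Fin n) ℝ) (hQ : Qᵀ * Q = 1)
    (d : Fin n → ℝ) (hd : ∀ i, 0 < d i)
    (hGdiag : G = Q * Matrix.diagonal d * Qᵀ)
    (H : Matrix (Fin n × Fin n) (Fin n × Fin n) ℝ)
    (hH : H = (G⁻¹ ⊗ₖ (1 : Matrix (Fin n) (Fin n) ℝ)) * (Q ⊗ₖ Q) *
      ((1 : Matrix (Fin n) (Fin n) ℝ) ⊗ₖ Matrix.diagonal d +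
        Matrix.diagonal d ⊗ₖ (1 : Matrix (Fin n) (Fin n) ℝ))⁻¹ *
      (Matrix.diagonal d ⊗ₖ (1 : Matrix (Fin n) (Fin n) ℝ)) * (Q ⊗ₖ Q)ᵀ) :
    specNorm H ≤ condNum Zstar ^ 4 / 2 := by
  subst hH
  rw [hGdiag] at hG ⊢
  have : Nonempty (Fin n) := by
    by_contra hn
    rw [not_nonempty_iff] at hn
    have h0 : Zstar = 0 := Subsingleton.elim _ _
    simp [h0, specNorm] at hZnorm
  set σ := sigmaMin Zstar with hσ
  have hσd (i) : σ ^ 2 ≤ d i := sigmaMin_sq_le_of_mul_transpose_eq hQ hG.symm i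
  have hσ_pos : 0 < σ := by
    refine sigmaMin_pos_of_mul_transpose_eq_one
      (W := Q * Matrix.diagonal (fun i => (d i)⁻¹) * Qᵀ * Zstar) ?_
    rw [Matrix.mul_assoc, ← hG, ← inv_mul_diagonal_mul_transpose hQ hd]
    refine Matrix.nonsing_inv_mul _ ?_
    have hQdet : Q.det * Q.det = 1 := by simpa using congrArg Matrix.det hQ
    have hdet : (Q * Matrix.diagonal d * Qᵀ).det = ∏ i, d i := by
      rw [Matrix.det_mul, Matrix.det_mul, Matrix.det_transpose, Matrix.det_diagonal]
      linear_combination (∏ i, d i) * hQdet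
    rw [hdet]
    exact (Finset.prod_pos fun i _ => hd i).ne'.isUnit
  have hσ_le : σ ≤ 1 := hZnorm ▸ sigmaMin_le_specNorm Zstar
  have hU : (Q ⊗ₖ Q)ᵀ * (Q ⊗ₖ Q) = 1 := by
    rw [← Matrix.kroneckerMap_transpose, ← Matrix.mul_kronecker_mul, hQ,
      Matrix.one_kronecker_one]
  rw [kronecker_diagonal_conj_eq hQ hd, condNum, hZnorm, ← hσ]
  have hσ2 : σ ^ 4 ≤ σ ^ 2 := pow_le_pow_of_le_one hσ_pos.le hσ_le (by norm_num)
  refine (specNorm_conj_le hU _).trans (specNorm_diagonal_le (by positivity) fun p => ?_)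
  have hp : 2 * σ ^ 4 ≤ d p.1 + d p.2 := by linarith [hσd p.1, hσd p.2]
  rw [abs_of_pos (inv_pos.2 (add_pos (hd _) (hd _)))]
  calc (d p.1 + d p.2)⁻¹ ≤ (2 * σ ^ 4)⁻¹ := inv_anti₀ (by positivity) hp
    _ = (1 / σ) ^ 4 / 2 := by field_simp
end
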